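/- Let A, B ∈ ℂ[t] with deg(A) = 1. Then the Abel equation x' = A(t)x³ + B(t)x² has two distinct invariant curves — i.e., there exist p₁ ≠ p₂ in ℂ[t], both nonzero, with pᵢpᵢ' − pᵢB + A = 0 for i = 1, 2 — if and only if there exist p ∈ ℂ[t] and K ∈ ℂ with K ≠ 0 and K ≠ 1 such that A = K·p·p' and B = (K + 1)·p'. -/

import Mathlib

open Polynomial

theorem derivative_eq_C_coeff_one {A : ℂ[X]} (hA : A.natDegree = 1) :
    derivative A = C (A.coeff 1) := by
  conv_lhs => rw [eq_X_add_C_of_natDegree_le_one hA.le]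
  simp

/-- If `A` has degree one, a polynomial `p` with `p p' - p B + A = 0` is either a nonzero constant
or a nonzero constant multiple of `A`. -/
theorem invariant_eq_C_or_eq_C_mul {A B p : ℂ[X]} (hA : A.natDegree = 1)
    (h : p * derivative p - p * B + A = 0) :
    (∃ c : ℂ, c ≠ 0 ∧ p = C c ∧ B = C c⁻¹ * A) ∨
      ∃ c : ℂ, c ≠ 0 ∧ p = C c * A ∧ B = C (c * A.coeff 1 + c⁻¹) := by
  have hA0 : A ≠ 0 := by rintro rfl; simp at hA
  have hfac : p * (B - derivative p) = A := by linear_combination -h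
  have hp : p ≠ 0 := by rintro rfl; exact hA0 (by simpa using hfac.symm)
  have hq : B - derivative p ≠ 0 := fun hq => hA0 (by simpa [hq] using hfac.symm)
  have hdeg : p.natDegree + (B - derivative p).natDegree = 1 := by
    rw [← natDegree_mul hp hq, hfac, hA]
  rcases Nat.eq_zero_or_pos p.natDegree with h0 | h0
  · obtain ⟨c, rfl⟩ := natDegree_eq_zero.mp h0
    have hc : c ≠ 0 := by simpa using hp
    refine Or.inl ⟨c, hc, rfl, ?_⟩
    rw [← hfac, ← mul_assoc, ← C_mul, inv_mul_cancel₀ hc]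
    simp
  · obtain ⟨c, hc⟩ := natDegree_eq_zero.mp (show (B - derivative p).natDegree = 0 by lia)
    have hc0 : c ≠ 0 := by rintro rfl; exact hq (by simpa using hc.symm)
    have hpA : p = C c⁻¹ * A := by
      rw [← hfac, ← hc, mul_comm p, ← mul_assoc, ← C_mul, inv_mul_cancel₀ hc0, C_1, one_mul]
    have hdp : derivative p = C (c⁻¹ * A.coeff 1) := by
      rw [hpA, derivative_C_mul, derivative_eq_C_coeff_one hA, C_mul]
    refine Or.inr ⟨c⁻¹, inv_ne_zero hc0, hpA, ?_⟩
    rw [inv_inv, C_add, ← hdp, hc]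
    ring

/-- for `deg A = 1`, the Abel equation has two distinct invariant curves iff
`A = K p p'` and `B = (K+1) p'` for some `p ∈ ℂ[t]` and `K ∈ ℂ`, `K ≠ 0, 1`. -/
theorem abel_degree_one_two_invariants (A B : ℂ[X]) (hA : A.natDegree = 1) :
    (∃ p₁ p₂ : ℂ[X], p₁ ≠ p₂ ∧ p₁ ≠ 0 ∧ p₂ ≠ 0 ∧
      p₁ * derivative p₁ - p₁ * B + A = 0 ∧
      p₂ * derivative p₂ - p₂ * B + A = 0) ↔
    (∃ (p : ℂ[X]) (K : ℂ), K ≠ 0 ∧ K ≠ 1 ∧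
      A = Polynomial.C K * (p * derivative p) ∧
      B = Polynomial.C (K + 1) * derivative p) := by
  have hA0 : A ≠ 0 := by rintro rfl; simp at hA
  have ha : A.coeff 1 ≠ 0 := by
    rw [← hA]
    exact leadingCoeff_ne_zero.mpr hA0
  have hdA := derivative_eq_C_coeff_one hA
  have hmixed : ∀ c d : ℂ, c ≠ 0 → B = C c⁻¹ * A → B ≠ C d := by
    intro c d hc hB hB'
    have := congrArg (fun q => coeff q 1) (hB.symm.trans hB')
    simp [hc, ha] at this
  constructor
  · rintro ⟨p₁, p₂, hne, -, -, h₁, h₂⟩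
    rcases invariant_eq_C_or_eq_C_mul hA h₁ with ⟨c, hc, hp₁, hBc⟩ | ⟨c, hc, hp₁, hBc⟩ <;>
      rcases invariant_eq_C_or_eq_C_mul hA h₂ with ⟨d, hd, hp₂, hBd⟩ | ⟨d, hd, hp₂, hBd⟩
    · have hcd : c⁻¹ = d⁻¹ := C_injective (mul_right_cancel₀ hA0 (hBc.symm.trans hBd))
      exact absurd (by rw [hp₁, hp₂, inv_injective hcd]) hne
    · exact absurd hBd (hmixed c _ hc hBc)
    · exact absurd hBc (hmixed d _ hd hBd)
    · have hcd : c ≠ d := by rintro rfl; exact hne (hp₁.trans hp₂.symm)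
      have hsum : c * A.coeff 1 + c⁻¹ = d * A.coeff 1 + d⁻¹ := C_injective (hBc.symm.trans hBd)
      have hprod : A.coeff 1 * (c * d) = 1 := by
        field_simp at hsum
        exact mul_left_cancel₀ (sub_ne_zero.mpr hcd) (by linear_combination hsum)
      refine ⟨p₁, d / c, div_ne_zero hd hc, ?_, ?_, ?_⟩
      · rw [Ne, div_eq_one_iff_eq hc]
        exact hcd.symm
      · have hK : d / c * (c * (c * A.coeff 1)) = 1 := by
          field_simp
          linear_combination hprod
        calc A = C (d / c * (c * (c * A.coeff 1))) * A := by rw [hK, C_1, one_mul]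
          _ = _ := by
            rw [hp₁, derivative_C_mul, hdA]
            simp only [C_mul]
            ring
      · rw [hBc, hp₁, derivative_C_mul, hdA, ← C_mul, ← C_mul]
        congr 1
        field_simp
        linear_combination -hprod
  · rintro ⟨p, K, hK0, hK1, hAp, hBp⟩
    have hp : p ≠ 0 := by rintro rfl; exact hA0 (by simpa using hAp)
    refine ⟨p, C K * p, ?_, hp, mul_ne_zero (C_ne_zero.mpr hK0) hp, ?_, ?_⟩
    · intro h
      exact hK1 (C_injective (mul_right_cancel₀ hp (by rw [← h, C_1, one_mul])))
    · rw [hAp, hBp, C_add, C_1]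
      ring
    · rw [hAp, hBp, derivative_C_mul, C_add, C_1]
      ring
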